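/- During each two consecutive steps of the scalar HK dynamics, any maximal d-chain of the sorted opinion vector x(k) either collapses into a singleton (all its opinions become equal), or splits into several maximal d-chains, or its diameter decreases by at least d/n²: that is, for every maximal d-chain S of x(k), either all agents of S share one opinion at step k+2, or S is no longer contained in a single maximal d-chain at step k+2, or diam_S(x(k+2)) ≤ diam_S(x(k)) − d/n², where diam_S(x) = max_{i∈S} x_i − min_{i∈S} x_i. -/

import Mathlib

open Finset

/-- The agents trusted by agent `i` for the opinion vector `x`. -/
noncomputable def hkNeighbors {n : ℕ} (d : ℝ) (x : Fin n → ℝ) (i : Fin n) : Finset (Fin n) :=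
  univ.filter (fun j => |x j - x i| ≤ d)

/-- One step of the scalar Hegselmann–Krause dynamics. -/
noncomputable def hkStep {n : ℕ} (d : ℝ) (x : Fin n → ℝ) (i : Fin n) : ℝ :=
  (∑ j ∈ hkNeighbors d x i, x j) / ((hkNeighbors d x i).card : ℝ)

/-- Two agents are joined by a walk in the influence graph of `x`. -/
def HKJoined {n : ℕ} (d : ℝ) (x : Fin n → ℝ) : Fin n → Fin n → Prop :=
  Relation.ReflTransGen (fun a b => |x a - x b| ≤ d)

section HegselmannKrause

variable {n : ℕ} {d : ℝ} {x : Fin n → ℝ}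

theorem mem_hkNeighbors {i j : Fin n} : j ∈ hkNeighbors d x i ↔ |x j - x i| ≤ d := by
  simp [hkNeighbors]

theorem self_mem_hkNeighbors (hd : 0 ≤ d) (i : Fin n) : i ∈ hkNeighbors d x i := by
  simpa [mem_hkNeighbors] using hd

theorem hkNeighbors_card_pos (hd : 0 ≤ d) (i : Fin n) :
    (0 : ℝ) < ((hkNeighbors d x i).card : ℝ) :=
  Nat.cast_pos.mpr (card_pos.mpr ⟨i, self_mem_hkNeighbors hd i⟩)

theorem HKJoined.symm {i j : Fin n} (h : HKJoined d x i j) : HKJoined d x j i :=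
  have : Std.Symm (fun a b => |x a - x b| ≤ d) := ⟨fun a b hab => by rwa [abs_sub_comm]⟩
  Relation.ReflTransGen.stdSymm.symm _ _ h

theorem HKJoined.of_mem_hkNeighbors {i j : Fin n} (h : j ∈ hkNeighbors d x i) :
    HKJoined d x i j :=
  Relation.ReflTransGen.single (by rw [abs_sub_comm]; exact mem_hkNeighbors.mp h)

theorem le_hkStep (hd : 0 ≤ d) {i : Fin n} {m : ℝ} (h : ∀ j ∈ hkNeighbors d x i, m ≤ x j) :
    m ≤ hkStep d x i := by
  rw [hkStep, le_div_iff₀ (hkNeighbors_card_pos hd i), mul_comm, ← nsmul_eq_mul]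
  exact card_nsmul_le_sum _ _ _ h

theorem hkStep_le (hd : 0 ≤ d) {i : Fin n} {m : ℝ} (h : ∀ j ∈ hkNeighbors d x i, x j ≤ m) :
    hkStep d x i ≤ m := by
  rw [hkStep, div_le_iff₀ (hkNeighbors_card_pos hd i), mul_comm, ← nsmul_eq_mul]
  exact sum_le_card_nsmul _ _ _ h

/-- A trusted agent lying `c` above a common lower bound lifts the average by `c / n`. -/
theorem add_div_le_hkStep (hd : 0 ≤ d) {i j : Fin n} {m c : ℝ} (hc : 0 ≤ c)
    (h : ∀ j ∈ hkNeighbors d x i, m ≤ x j) (hj : j ∈ hkNeighbors d x i) (hjc : m + c ≤ x j) :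
    m + c / n ≤ hkStep d x i := by
  have hpos := hkNeighbors_card_pos (x := x) hd i
  have hcard : ((hkNeighbors d x i).card : ℝ) ≤ n := by
    exact_mod_cast (card_le_univ _).trans_eq (Fintype.card_fin n)
  have hle : c / n ≤ c / (hkNeighbors d x i).card := by gcongr
  have hsum : c ≤ ∑ l ∈ hkNeighbors d x i, (x l - m) :=
    le_trans (by linarith)
      (single_le_sum (f := fun l => x l - m) (fun l hl => sub_nonneg.mpr (h l hl)) hj)
  rw [sum_sub_distrib, sum_const, nsmul_eq_mul] at hsum
  have : m + c / (hkNeighbors d x i).card ≤ hkStep d x i := by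
    rw [hkStep, le_div_iff₀ hpos, add_mul, div_mul_cancel₀ _ hpos.ne']
    linarith
  linarith

theorem hkNeighbors_congr {i j : Fin n} (h : x i = x j) :
    hkNeighbors d x i = hkNeighbors d x j := by
  simp [hkNeighbors, h]

theorem hkStep_congr {i j : Fin n} (h : x i = x j) : hkStep d x i = hkStep d x j := by
  simp [hkStep, hkNeighbors_congr h]

/-- Walking inside a component does not cross an agent of another component. -/
theorem HKJoined.lt_of_not_joined {u u' v : Fin n} (h : HKJoined d x u u')
    (hv : ¬ HKJoined d x u v) (hlt : x u + d < x v) : x u' + d < x v := by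
  induction h with
  | refl => exact hlt
  | @tail b c hub hbc ih =>
    have hcv : ¬ |x c - x v| ≤ d := fun hcv => hv ((hub.tail hbc).tail hcv)
    by_contra hcon
    refine hcv (abs_le.mpr ⟨?_, ?_⟩) <;> linarith [abs_le.mp hbc]

theorem HKJoined.gt_of_not_joined {u u' v : Fin n} (h : HKJoined d x u u')
    (hv : ¬ HKJoined d x u v) (hlt : x v + d < x u) : x v + d < x u' := by
  induction h with
  | refl => exact hlt
  | @tail b c hub hbc ih =>
    have hcv : ¬ |x c - x v| ≤ d := fun hcv => hv ((hub.tail hbc).tail hcv)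
    by_contra hcon
    refine hcv (abs_le.mpr ⟨?_, ?_⟩) <;> linarith [abs_le.mp hbc]

theorem hkStep_add_lt_of_not_joined (hd : 0 ≤ d) {a b : Fin n} (h : ¬ HKJoined d x a b)
    (hlt : x a + d < x b) : hkStep d x a + d < hkStep d x b := by
  obtain ⟨u, hu, hmax⟩ := exists_max_image (hkNeighbors d x a) x ⟨a, self_mem_hkNeighbors hd a⟩
  obtain ⟨v, hv, hmin⟩ := exists_min_image (hkNeighbors d x b) x ⟨b, self_mem_hkNeighbors hd b⟩
  have hau := HKJoined.of_mem_hkNeighbors hu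
  have hub : ¬ HKJoined d x b u := fun hbu => h (hau.trans hbu.symm)
  have hsep := (HKJoined.of_mem_hkNeighbors hv).gt_of_not_joined hub (hau.lt_of_not_joined h hlt)
  linarith [hkStep_le hd hmax, le_hkStep hd hmin]

/-- Components never merge along the dynamics. -/
theorem HKJoined.of_hkStep (hd : 0 ≤ d) {i j : Fin n} (h : HKJoined d (hkStep d x) i j) :
    HKJoined d x i j := by
  induction h with
  | refl => exact .refl
  | @tail b c _ hbc ih =>
    refine ih.trans (show HKJoined d x b c from ?_)
    by_contra hn
    have hedge : ¬ |x b - x c| ≤ d := fun he => hn (Relation.ReflTransGen.single he)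
    have hbc' := abs_le.mp hbc
    rcases lt_abs.mp (not_le.mp hedge) with hlt | hlt
    · linarith [hkStep_add_lt_of_not_joined hd (fun h => hn h.symm) (show x c + d < x b by linarith)]
    · linarith [hkStep_add_lt_of_not_joined hd hn (show x b + d < x c by linarith)]

/-- After one step, an agent of a component either agrees with its minimal agent `a`, or lies at
least `d / n` above the old minimum. -/
theorem hkStep_eq_or_add_div_le (hd : 0 ≤ d) {a p : Fin n}
    (hmin : ∀ j, HKJoined d x a j → x a ≤ x j) (hp : HKJoined d x a p) :
    hkStep d x p = hkStep d x a ∨ x a + d / n ≤ hkStep d x p := by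
  have hnb : ∀ j ∈ hkNeighbors d x p, x a ≤ x j := fun j hj =>
    hmin j (hp.trans (HKJoined.of_mem_hkNeighbors hj))
  by_cases hfar : ∃ j ∈ hkNeighbors d x p, x a + d ≤ x j
  · obtain ⟨j, hj, hjd⟩ := hfar
    exact .inr (add_div_le_hkStep hd hd hnb hj hjd)
  · push Not at hfar
    have hpa := hfar p (self_mem_hkNeighbors hd p)
    have hpa' := hmin p hp
    have : hkNeighbors d x p = hkNeighbors d x a := by
      ext j
      refine ⟨fun hj => ?_, fun hj => ?_⟩
      · have := hfar j hj
        have := hnb j hj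
        exact mem_hkNeighbors.mpr (abs_le.mpr ⟨by linarith, by linarith⟩)
      · have := hmin j (HKJoined.of_mem_hkNeighbors hj)
        have := abs_le.mp (mem_hkNeighbors.mp hj)
        exact mem_hkNeighbors.mpr (abs_le.mpr ⟨by linarith, by linarith⟩)
    exact .inl (by simp [hkStep, this])

theorem exists_edge_of_hkJoined_of_ne {a p : Fin n} (h : HKJoined d x a p) (hne : x p ≠ x a) :
    ∃ q, HKJoined d x a q ∧ x q ≠ x a ∧ |x q - x a| ≤ d := by
  induction h with
  | refl => exact absurd rfl hne
  | @tail b c hab hbc ih =>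
    by_cases hb : x b = x a
    · exact ⟨c, hab.tail hbc, hne, by rwa [abs_sub_comm, ← hb]⟩
    · exact ih hb

/-- If a component stays connected for one step without collapsing, its minimum rises by at
least `d / n ^ 2` in two steps. -/
theorem add_div_sq_le_hkStep_hkStep (hd : 0 ≤ d) {a p i : Fin n}
    (hmin : ∀ j, HKJoined d x a j → x a ≤ x j)
    (hp : HKJoined d (hkStep d x) a p) (hne : hkStep d x p ≠ hkStep d x a)
    (hi : HKJoined d x a i) :
    x a + d / (n ^ 2 : ℝ) ≤ hkStep d (hkStep d x) i := by
  have hlow : ∀ l, HKJoined d x a l → x a ≤ hkStep d x l := fun l hl =>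
    le_hkStep hd fun j hj => hmin j (hl.trans (HKJoined.of_mem_hkNeighbors hj))
  obtain ⟨q, hq, hqne, hqa⟩ := exists_edge_of_hkJoined_of_ne hp hne
  obtain ⟨l, hl, hlc⟩ : ∃ l ∈ hkNeighbors d (hkStep d x) i, x a + d / n ≤ hkStep d x l := by
    rcases hkStep_eq_or_add_div_le hd hmin hi with h | h
    · exact ⟨q, mem_hkNeighbors.mpr (by rwa [h]),
        (hkStep_eq_or_add_div_le hd hmin (hq.of_hkStep hd)).resolve_left hqne⟩
    · exact ⟨i, self_mem_hkNeighbors hd i, h⟩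
  rw [sq, ← div_div]
  exact add_div_le_hkStep hd (by positivity)
    (fun j hj => hlow j (hi.trans ((HKJoined.of_mem_hkNeighbors hj).of_hkStep hd))) hl hlc

end HegselmannKrause

/-- **Behavior of maximal `d`-chains over two steps (Bhat–Chazelle).**
Along the scalar HK dynamics with sorted opinions, consider at step `k` a
maximal `d`-chain, i.e. a connected component `S` of the influence graph
(the equivalence class of some agent `i₀` under the reflexive–transitive
closure of the edge relation `|x a - x b| ≤ d`).  Then after two steps
either all agents of `S` share one opinion, or `S` is no longer contained in
a single maximal `d`-chain (some two of its agents are no longer joined by a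
walk in the influence graph), or the diameter of the opinions of `S` has
decreased by at least `d / n²`. -/
theorem hk_chain_two_steps (n : ℕ) (d : ℝ) (hd : 0 < d)
    (x : ℕ → Fin n → ℝ)
    (hdyn : ∀ k i, x (k + 1) i =
      (∑ j ∈ univ.filter (fun j => |x k j - x k i| ≤ d), x k j) /
      ((univ.filter (fun j => |x k j - x k i| ≤ d)).card : ℝ))
    (hsorted : Monotone (x 0))
    (k : ℕ) (i₀ : Fin n) (S : Set (Fin n))
    (hS : S = {j | Relation.ReflTransGen (fun a b => |x k a - x k b| ≤ d) i₀ j}) :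
    (∀ i ∈ S, ∀ j ∈ S, x (k + 2) i = x (k + 2) j) ∨
    (∃ i ∈ S, ∃ j ∈ S,
      ¬ Relation.ReflTransGen
        (fun a b => |x (k + 2) a - x (k + 2) b| ≤ d) i j) ∨
    (sSup (x (k + 2) '' S) - sInf (x (k + 2) '' S) ≤
      (sSup (x k '' S) - sInf (x k '' S)) - d / (n ^ 2 : ℝ)) := by
  have hstep : ∀ k, x (k + 1) = hkStep d (x k) := fun k => funext (hdyn k)
  have h2 : x (k + 2) = hkStep d (hkStep d (x k)) := by rw [hstep (k + 1), hstep k]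
  rw [h2]
  generalize x k = y at hS ⊢
  have hmem : ∀ j, j ∈ S ↔ HKJoined d y i₀ j := fun j => by rw [hS]; rfl
  by_cases hconn : ∀ i ∈ S, ∀ j ∈ S, HKJoined d (hkStep d (hkStep d y)) i j
  swap
  · push Not at hconn
    exact .inr (.inl hconn)
  have hne : S.Nonempty := ⟨i₀, (hmem i₀).mpr .refl⟩
  obtain ⟨a, haS, hamin⟩ := Set.exists_min_image S y S.toFinite hne
  obtain ⟨b, hbS, hbmax⟩ := Set.exists_max_image S y S.toFinite hne
  by_cases hcol : ∀ i ∈ S, hkStep d y i = hkStep d y a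
  · exact .inl fun i hi j hj => hkStep_congr ((hcol i hi).trans (hcol j hj).symm)
  push Not at hcol
  obtain ⟨p, hpS, hp⟩ := hcol
  have hS_of {i j : Fin n} (hi : i ∈ S) (hij : HKJoined d y i j) : j ∈ S :=
    (hmem j).mpr (((hmem i).mp hi).trans hij)
  have hlow : ∀ i ∈ S, y a + d / (n ^ 2 : ℝ) ≤ hkStep d (hkStep d y) i := fun i hi =>
    add_div_sq_le_hkStep_hkStep hd.le (fun j hj => hamin j (hS_of haS hj))
      ((hconn a haS p hpS).of_hkStep hd.le) hp (((hmem a).mp haS).symm.trans ((hmem i).mp hi))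
  have hupp : ∀ i ∈ S, hkStep d (hkStep d y) i ≤ y b := fun i hi =>
    hkStep_le hd.le fun j hj => hkStep_le hd.le fun l hl =>
      hbmax l (hS_of (hS_of hi ((HKJoined.of_mem_hkNeighbors hj).of_hkStep hd.le))
        (HKJoined.of_mem_hkNeighbors hl))
  have hsup : sSup (hkStep d (hkStep d y) '' S) ≤ y b :=
    csSup_le (hne.image _) (Set.forall_mem_image.mpr hupp)
  have hinf : y a + d / (n ^ 2 : ℝ) ≤ sInf (hkStep d (hkStep d y) '' S) :=
    le_csInf (hne.image _) (Set.forall_mem_image.mpr hlow)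
  have hsup' : y b ≤ sSup (y '' S) :=
    le_csSup (S.toFinite.image y).bddAbove (Set.mem_image_of_mem y hbS)
  have hinf' : sInf (y '' S) ≤ y a :=
    csInf_le (S.toFinite.image y).bddBelow (Set.mem_image_of_mem y haS)
  exact .inr (.inr (by linarith))
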